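/- Let M be an NFA with n states and let k ≥ 2 be an integer. If the language L(M) accepted by M contains a k-power, then L(M) contains a k-power of length at most k·nᵏ. -/

import Mathlib

/-- `listPow x m` is the concatenation of `m` copies of the word `x`. -/
def listPow {α : Type*} (x : List α) (m : ℕ) : List α := (List.replicate m x).flatten

/-- A word is a `k`-power if it is the concatenation of `k` copies of a non-empty word. -/
def IsKPower {α : Type*} (k : ℕ) (w : List α) : Prop :=
  ∃ x : List α, x ≠ [] ∧ w = listPow x k

/-- A word is a power if it is a `k`-power for some `k ≥ 2`. -/
def IsPower {α : Type*} (w : List α) : Prop := ∃ k : ℕ, 2 ≤ k ∧ IsKPower k w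

/-- A non-empty word is primitive if it is not a power. -/
def IsPrimitive {α : Type*} (w : List α) : Prop := w ≠ [] ∧ ¬ IsPower w

/-- A word is bordered if it has the form `u ++ w ++ u` with `u` non-empty. -/
def Bordered {α : Type*} (x : List α) : Prop :=
  ∃ u w : List α, u ≠ [] ∧ x = u ++ w ++ u

/-- A language is slender if the number of words of each length is bounded by a constant. -/
def Slender {α : Type*} (L : Language α) : Prop :=
  ∃ C : ℕ, ∀ r : ℕ, {w | w ∈ L ∧ w.length = r}.Finite ∧
    {w | w ∈ L ∧ w.length = r}.ncard < C

theorem listPow_succ_aux {α : Type*} (x : List α) (m : ℕ) :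
    listPow x (m + 1) = listPow x m ++ x := by
  simp [listPow, List.replicate_succ']

theorem listPow_length_aux {α : Type*} (x : List α) (m : ℕ) :
    (listPow x m).length = m * x.length := by
  simp [listPow]

theorem evalFrom_append_iff_aux {α σ : Type*} (M : NFA α σ) (S : Set σ) (x y : List α) (t : σ) :
    t ∈ M.evalFrom S (x ++ y) ↔ ∃ r, r ∈ M.evalFrom S x ∧ t ∈ M.evalFrom {r} y := by
  rw [NFA.evalFrom_append, NFA.mem_evalFrom_iff_exists]

theorem evalFrom_listPow_aux {α σ : Type*} (M : NFA α σ) (S : Set σ) (x : List α) (k : ℕ) (t : σ) :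
    t ∈ M.evalFrom S (listPow x k) ↔
      ∃ q : ℕ → σ, q 0 ∈ S ∧ q k = t ∧ ∀ i < k, q (i + 1) ∈ M.evalFrom {q i} x := by
  induction k generalizing t with
  | zero =>
    constructor
    · intro h
      exact ⟨fun _ => t, by simpa [listPow] using h, rfl, by simp⟩
    · rintro ⟨q, h0, rfl, -⟩
      simpa [listPow] using h0
  | succ k ih =>
    rw [listPow_succ_aux, evalFrom_append_iff_aux]
    constructor
    · rintro ⟨r, hr, ht⟩
      obtain ⟨q, h0, hk, hq⟩ := (ih r).1 hr
      refine ⟨fun i => if i ≤ k then q i else t, by simpa using h0, by simp, ?_⟩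
      intro i hi
      rcases Nat.lt_or_ge i k with h | h
      · have h1 : i + 1 ≤ k := h
        have h2 : i ≤ k := h.le
        simpa [h1, h2] using hq i h
      · obtain rfl : i = k := by omega
        simpa [hk] using ht
    · rintro ⟨q, h0, rfl, hq⟩
      exact ⟨q k, (ih _).2 ⟨q, h0, rfl, fun i hi => hq i (by omega)⟩, hq k (by omega)⟩

/-- A long `k`-th root of an accepted word can be shortened. -/
theorem shorten_aux {α σ : Type*} [Fintype σ] (M : NFA α σ) (k : ℕ) (x : List α)
    (hx : listPow x k ∈ M.accepts) (hlen : Fintype.card σ ^ k < x.length) :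
    ∃ y : List α, y ≠ [] ∧ y.length < x.length ∧ listPow y k ∈ M.accepts := by
  obtain ⟨t, hta, ht⟩ := NFA.mem_accepts.1 hx
  obtain ⟨q, h0, hk, hq⟩ := (evalFrom_listPow_aux M _ x k t).1 ht
  have key : ∀ (i : Fin k) (j : Fin x.length), ∃ r,
      r ∈ M.evalFrom {q i} (x.take (j + 1)) ∧ q (i + 1) ∈ M.evalFrom {r} (x.drop (j + 1)) := by
    intro i j
    rw [← evalFrom_append_iff_aux, List.take_append_drop]
    exact hq i i.2
  choose r hr1 hr2 using key
  obtain ⟨a, b, hab, he⟩ := Fintype.exists_ne_map_eq_of_card_lt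
    (fun (j : Fin x.length) (i : Fin k) => r i j) (by classical simpa using hlen)
  have main : ∀ a b : Fin x.length, a < b → (∀ i, r i a = r i b) →
      ∃ y : List α, y ≠ [] ∧ y.length < x.length ∧ listPow y k ∈ M.accepts := by
    intro a b hab he
    have hab' : (a : ℕ) < b := hab
    have hl : (x.take (a + 1) ++ x.drop (b + 1)).length = (a + 1) + (x.length - (b + 1)) := by
      simp only [List.length_append, List.length_take, List.length_drop]
      omega
    refine ⟨x.take (a + 1) ++ x.drop (b + 1), ?_, by omega, ?_⟩
    · intro h
      rw [h] at hl
      simp only [List.length_nil] at hl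
      omega
    · refine NFA.mem_accepts.2 ⟨t, hta, (evalFrom_listPow_aux M _ _ k t).2 ⟨q, h0, hk, ?_⟩⟩
      intro i hi
      rw [evalFrom_append_iff_aux]
      refine ⟨r ⟨i, hi⟩ a, hr1 ⟨i, hi⟩ a, ?_⟩
      rw [he]
      exact hr2 ⟨i, hi⟩ b
  rcases lt_or_gt_of_ne hab with h | h
  · exact main a b h fun i => congrFun he i
  · exact main b a h fun i => (congrFun he i).symm

/-- If an n-state NFA accepts a k-power, it accepts a k-power of length at most k·nᵏ. -/
theorem nfa_accepts_short_kpower {α σ : Type*} [Fintype σ] (M : NFA α σ) (n : ℕ)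
    (hn : Fintype.card σ = n) (k : ℕ) (hk : 2 ≤ k)
    (h : ∃ w ∈ M.accepts, IsKPower k w) :
    ∃ w ∈ M.accepts, IsKPower k w ∧ w.length ≤ k * n ^ k := by
  subst hn
  obtain ⟨w, hw, x, hx, rfl⟩ := h
  induction hl : x.length using Nat.strong_induction_on generalizing x with
  | _ m ih =>
    subst hl
    rcases Nat.lt_or_ge (Fintype.card σ ^ k) x.length with h | h
    · obtain ⟨y, hy, hyl, hya⟩ := shorten_aux M k x hw h
      exact ih y.length hyl y hy hya rfl
    · refine ⟨_, hw, ⟨x, hx, rfl⟩, ?_⟩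
      rw [listPow_length_aux]
      exact Nat.mul_le_mul_left k h
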